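/- Conditional mean of a jointly Gaussian scalar: let n ≥ 1 and let (X, Z) : Ω → ℝⁿ × ℝ be jointly Gaussian with μ_X := E[X], μ_Z := E[Z], invertible covariance matrix Σ_XX := Cov(X), and c := Cov(X, Z) ∈ ℝⁿ. Then, almost surely, E[Z | σ(X)] = μ_Z + ⟨Σ_XX^{-1} c, X − μ_X⟩. -/

import Mathlib

open Matrix MeasureTheory ProbabilityTheory
open scoped NNReal

/-- Covariance of two real random variables. -/
noncomputable def cov {Ω : Type*} [MeasurableSpace Ω] (P : Measure Ω) (X Y : Ω → ℝ) : ℝ :=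
  ∫ ω, (X ω - ∫ ω', X ω' ∂P) * (Y ω - ∫ ω', Y ω' ∂P) ∂P

/-- `(X, Z)` is jointly Gaussian: the pushforward of the law under every linear
functional of the coordinates is a (possibly degenerate) one-dimensional Gaussian. -/
def IsJointGaussian {Ω : Type*} [MeasurableSpace Ω] {n : ℕ} (P : Measure Ω)
    (X : Ω → Fin n → ℝ) (Z : Ω → ℝ) : Prop :=
  ∀ (b : Fin n → ℝ) (a : ℝ), ∃ m : ℝ, ∃ v : ℝ≥0,
    Measure.map (fun ω => (∑ j, b j * X ω j) + a * Z ω) P = gaussianReal m v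

lemma cov_eq_covariance {Ω : Type*} [MeasurableSpace Ω] (P : Measure Ω) (X Y : Ω → ℝ) :
    cov P X Y = covariance X Y P := rfl

lemma IsJointGaussian.hasGaussianLaw {Ω : Type*} [MeasurableSpace Ω] {P : Measure Ω} {n : ℕ}
    {X : Ω → Fin n → ℝ} {Z : Ω → ℝ} (hX : Measurable X) (hZ : Measurable Z)
    (h : IsJointGaussian P X Z) : HasGaussianLaw (fun ω ↦ (X ω, Z ω)) P := by
  refine ⟨isGaussian_of_map_eq_gaussianReal fun L ↦ ?_⟩
  obtain ⟨m, v, hmv⟩ := h (fun j ↦ L (Pi.single j 1, 0)) (L (0, 1))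
  refine ⟨m, v, ?_⟩
  rw [Measure.map_map (by fun_prop) (by fun_prop), ← hmv]
  congr 1
  ext ω
  have hω : (X ω, Z ω) = ∑ j, X ω j • ((Pi.single j 1, 0) : (Fin n → ℝ) × ℝ)
      + Z ω • ((0, 1) : (Fin n → ℝ) × ℝ) := by
    ext i
    · simp [Prod.fst_sum, Finset.sum_apply, Pi.single_apply]
    · simp [Prod.snd_sum]
  simp only [Function.comp_apply]
  rw [hω, map_add, map_sum, map_smul]
  simp only [map_smul, smul_eq_mul, mul_comm]

/-- The residual of a jointly Gaussian variable after subtracting a solution of the normal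
equations is independent of the regressors. -/
lemma ProbabilityTheory.HasGaussianLaw.indepFun_sub_sum {Ω ι : Type*} [MeasurableSpace Ω]
    [Fintype ι] {P : Measure Ω} {X : Ω → ι → ℝ} {Z : Ω → ℝ}
    (h : HasGaussianLaw (fun ω ↦ (X ω, Z ω)) P) (a : ι → ℝ)
    (ha : ∀ i, ∑ j, covariance (fun ω ↦ X ω i) (fun ω ↦ X ω j) P * a j =
      covariance (fun ω ↦ X ω i) Z P) :
    IndepFun X (fun ω ↦ Z ω - ∑ j, a j * X ω j) P := by
  have := h.isProbabilityMeasure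
  have hX (j : ι) : MemLp (fun ω ↦ X ω j) 2 P :=
    (HasGaussianLaw.eval (X := fun i ω ↦ X ω i) h.fst j).memLp_two
  let L : (ι → ℝ) × ℝ →L[ℝ] (ι → ℝ) × (Unit → ℝ) :=
    (ContinuousLinearMap.fst ℝ _ _).prod (ContinuousLinearMap.pi fun _ ↦
      ContinuousLinearMap.snd ℝ _ _ -
        ∑ j, a j • (ContinuousLinearMap.proj j ∘L ContinuousLinearMap.fst ℝ _ _))
  have hL : HasGaussianLaw
      (fun ω ↦ (fun i ↦ X ω i, fun _ : Unit ↦ Z ω - ∑ j, a j * X ω j)) P := by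
    convert! h.map_fun L using 2 with ω
    ext <;> simp [L]
  refine (HasGaussianLaw.indepFun_of_covariance_eval (X := fun i ω ↦ X ω i) hL
    fun i _ ↦ ?_).comp (φ := id) measurable_id (measurable_pi_apply ())
  rw [covariance_fun_sub_right (hX i) h.snd.memLp_two
    (memLp_finsetSum _ fun j _ ↦ (hX j).const_mul _),
    covariance_fun_sum_right (fun j ↦ (hX j).const_mul _) (hX i), sub_eq_zero, ← ha i]
  exact Finset.sum_congr rfl fun j _ ↦ by rw [covariance_const_mul_right, mul_comm]

/-- The conditional mean of a jointly Gaussian variable given the regressors is the affine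
function whose coefficients solve the normal equations. -/
lemma ProbabilityTheory.HasGaussianLaw.condExp_eq_of_normal_equations {Ω ι : Type*}
    [MeasurableSpace Ω] [Fintype ι] {P : Measure Ω} {X : Ω → ι → ℝ} {Z : Ω → ℝ}
    (h : HasGaussianLaw (fun ω ↦ (X ω, Z ω)) P) (hX : Measurable X) (hZ : Measurable Z)
    (a : ι → ℝ)
    (ha : ∀ i, ∑ j, covariance (fun ω ↦ X ω i) (fun ω ↦ X ω j) P * a j =
      covariance (fun ω ↦ X ω i) Z P) :
    P[Z | MeasurableSpace.comap X inferInstance] =ᵐ[P]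
      fun ω ↦ ∫ ω', Z ω' ∂P + ∑ j, a j * (X ω j - ∫ ω', X ω' j ∂P) := by
  have := h.isProbabilityMeasure
  have hXint (j : ι) : Integrable (fun ω ↦ X ω j) P :=
    (HasGaussianLaw.eval (X := fun i ω ↦ X ω i) h.fst j).integrable
  have hZint : Integrable Z P := h.snd.integrable
  let R : Ω → ℝ := fun ω ↦ Z ω - ∑ j, a j * X ω j
  let S : Ω → ℝ := fun ω ↦ ∑ j, a j * X ω j
  have hSint : Integrable S P := integrable_finsetSum _ fun j _ ↦ (hXint j).const_mul _
  have hRint : Integrable R P := hZint.sub hSint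
  have hRmeas : Measurable R := by fun_prop
  have hindep : IndepFun R X P := (h.indepFun_sub_sum a ha).symm
  have hR := condExp_indep_eq hRmeas.comap_le hX.comap_le
    (comap_measurable R).stronglyMeasurable hindep
  have hSmeas : StronglyMeasurable[MeasurableSpace.comap X inferInstance] S := by
    have : Measurable fun x : ι → ℝ ↦ ∑ j, a j * x j := by fun_prop
    exact (this.comp (comap_measurable X)).stronglyMeasurable
  have hS := condExp_of_stronglyMeasurable hX.comap_le hSmeas hSint
  have hZ_eq : Z = R + S := by ext ω; simp [R, S]
  have hR_mean : ∫ ω, R ω ∂P = ∫ ω, Z ω ∂P - ∑ j, a j * ∫ ω, X ω j ∂P := by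
    rw [integral_sub hZint hSint, integral_finsetSum _ fun j _ ↦ (hXint j).const_mul _]
    simp only [integral_const_mul]
  have hadd : P[Z | MeasurableSpace.comap X inferInstance] =ᵐ[P]
      P[R | MeasurableSpace.comap X inferInstance] +
        P[S | MeasurableSpace.comap X inferInstance] := by
    conv_lhs => rw [hZ_eq]
    exact condExp_add hRint hSint _
  filter_upwards [hadd, hR] with ω hω hRω
  rw [hω, Pi.add_apply, hRω, hS, hR_mean]
  simp only [S, mul_sub, Finset.sum_sub_distrib]
  ring

theorem stmt11 {Ω : Type*} [MeasurableSpace Ω] (P : Measure Ω) [IsProbabilityMeasure P]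
    {n : ℕ} (hn : 1 ≤ n) (X : Ω → Fin n → ℝ) (Z : Ω → ℝ)
    (hmX : Measurable X) (hmZ : Measurable Z)
    (hGauss : IsJointGaussian P X Z)
    (μX : Fin n → ℝ) (hμX : μX = fun j => ∫ ω, X ω j ∂P)
    (μZ : ℝ) (hμZ : μZ = ∫ ω, Z ω ∂P)
    (SigXX : Matrix (Fin n) (Fin n) ℝ)
    (hSigXX : SigXX = Matrix.of fun i j => cov P (fun ω => X ω i) (fun ω => X ω j))
    (hinv : IsUnit SigXX.det)
    (c : Fin n → ℝ) (hc : c = fun j => cov P (fun ω => X ω j) Z) :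
    P[Z | MeasurableSpace.comap X inferInstance] =ᵐ[P]
      fun ω => μZ + ∑ j, SigXX⁻¹.mulVec c j * (X ω j - μX j) := by
  subst hμX hμZ
  refine (hGauss.hasGaussianLaw hmX hmZ).condExp_eq_of_normal_equations hmX hmZ
    (SigXX⁻¹ *ᵥ c) fun i ↦ ?_
  have hSol : SigXX *ᵥ (SigXX⁻¹ *ᵥ c) = c := by
    rw [mulVec_mulVec, mul_nonsing_inv _ hinv, one_mulVec]
  have hi := congrFun hSol i
  rw [mulVec_eq_sum] at hi
  simpa [hSigXX, hc, cov_eq_covariance, mul_comm] using hi
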